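/- arXiv:1504.05940 — 2 statements merged into one kernel-verified Lean document; each statement's English description precedes it below -/
import Mathlib

section
/- (Large-deviations regime: vanishing Hoeffding sum.) Let W be a discrete memoryless channel with finite input alphabet 𝒳 and finite output alphabet 𝒴 such that W(y|x) > 0 for all x ∈ 𝒳, y ∈ 𝒴. Let C > 0 be a constant with I(P, W) ≤ C for every input distribution P on 𝒳 (e.g., C the capacity of W), and let V > 0 be a constant. Define α(λ) = λ/C − √(V·λ/C³)·log λ. For xᵗ ∈ 𝒳ᵗ let P_{xᵗ} be its type and let Yᵗ have law Π_{i=1}^t W(·|x_i). Then Σ_{t=0}^{⌊α(λ)⌋} max_{xᵗ ∈ 𝒳ᵗ} P[ i_{P_{xᵗ},W}(xᵗ; Yᵗ) > λ ] → 0 as λ → ∞. Moreover, for each t ≤ α(λ) and λ large enough, max_{xᵗ ∈ 𝒳ᵗ} P[ i_{P_{xᵗ},W}(xᵗ; Yᵗ) > λ ] ≤ (1/λ)^{c·log λ} for some constant c > 0 independent of t and λ. -/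
open MeasureTheory Real Filter

noncomputable section

/-- Information density `i_{P,W}(xᵗ; yᵗ) = ∑_i log (W(yᵢ|xᵢ) / PW(yᵢ))`,
where `PW(y) = ∑_x P(x)·W(y|x)`. -/
def infoDensity {𝓧 𝓨 : Type*} [Fintype 𝓧] (P : 𝓧 → ℝ) (W : 𝓧 → 𝓨 → ℝ)
    {n : ℕ} (xs : Fin n → 𝓧) (ys : Fin n → 𝓨) : ℝ :=
  ∑ i, Real.log (W (xs i) (ys i) / ∑ x, P x * W x (ys i))

/-- The type (empirical distribution) of the sequence `xs ∈ 𝓧ᵗ`. -/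
def typeDist {𝓧 : Type*} [Fintype 𝓧] [DecidableEq 𝓧] {t : ℕ} (xs : Fin t → 𝓧) (a : 𝓧) : ℝ :=
  ((Finset.univ.filter fun i => xs i = a).card : ℝ) / t

/-- Mutual information `I(P, W)`: the mean of the per-letter information density under
`P × W`. -/
def mutualInfo {𝓧 𝓨 : Type*} [Fintype 𝓧] [Fintype 𝓨] (P : 𝓧 → ℝ) (W : 𝓧 → 𝓨 → ℝ) : ℝ :=
  ∑ x, ∑ y, P x * W x y * Real.log (W x y / ∑ x', P x' * W x' y)

/-- `P[i_{P_{xᵗ},W}(xᵗ; Yᵗ) > λ]`, where `Yᵗ` has law `∏_i W(·|xᵢ)` and `P_{xᵗ}` is the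
type of `xᵗ`. -/
def tailP {𝓧 𝓨 : Type*} [Fintype 𝓧] [Fintype 𝓨] [DecidableEq 𝓧]
    (W : 𝓧 → 𝓨 → ℝ) {t : ℕ} (xs : Fin t → 𝓧) (lam : ℝ) : ℝ :=
  ∑ ys : Fin t → 𝓨,
    (∏ i, W (xs i) (ys i)) * (if lam < infoDensity (typeDist xs) W xs ys then 1 else 0)

/-- **Hoeffding's lemma** for a centred variable with values in `[-D, D]` on a finite space. -/
theorem sum_mul_exp_le_of_abs_le {β : Type*} [Fintype β] {p u : β → ℝ} {D : ℝ} (hD : 0 < D)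
    (hp : ∀ y, 0 ≤ p y) (hp1 : ∑ y, p y = 1) (hu : ∀ y, |u y| ≤ D)
    (hmean : ∑ y, p y * u y = 0) (s : ℝ) :
    ∑ y, p y * Real.exp (s * u y) ≤ Real.exp (s ^ 2 * D ^ 2 / 2) := by
  have hconv (y : β) :
      Real.exp (s * u y) ≤ Real.cosh (s * D) + u y * (Real.sinh (s * D) / D) := by
    have hy := abs_le.mp (hu y)
    have h := convexOn_exp.2 (Set.mem_univ (s * D)) (Set.mem_univ (-(s * D)))
      (show 0 ≤ (D + u y) / (2 * D) from div_nonneg (by linarith) (by linarith))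
      (show 0 ≤ (D - u y) / (2 * D) from div_nonneg (by linarith) (by linarith))
      (by field_simp; ring)
    simp only [smul_eq_mul] at h
    have h1 : (D + u y) / (2 * D) * (s * D) + (D - u y) / (2 * D) * (-(s * D)) = s * u y := by
      field_simp; ring
    rw [h1] at h
    refine h.trans_eq ?_
    rw [Real.cosh_eq, Real.sinh_eq]
    field_simp
    ring
  calc ∑ y, p y * Real.exp (s * u y)
      ≤ ∑ y, p y * (Real.cosh (s * D) + u y * (Real.sinh (s * D) / D)) :=
        Finset.sum_le_sum fun y _ => mul_le_mul_of_nonneg_left (hconv y) (hp y)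
    _ = (∑ y, p y) * Real.cosh (s * D) + (∑ y, p y * u y) * (Real.sinh (s * D) / D) := by
        rw [Finset.sum_mul, Finset.sum_mul, ← Finset.sum_add_distrib]
        exact Finset.sum_congr rfl fun y _ => by ring
    _ = Real.cosh (s * D) := by rw [hp1, hmean]; ring
    _ ≤ Real.exp (s ^ 2 * D ^ 2 / 2) := by
        rw [← mul_pow]; exact Real.cosh_le_exp_half_sq _

/-- **Hoeffding's inequality** for a product of finite probability spaces. -/
theorem sum_prod_mul_indicator_le {ι β : Type*} [Fintype ι] [DecidableEq ι] [Nonempty ι]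
    [Fintype β]
    {p u : ι → β → ℝ} {D δ : ℝ} (hD : 0 < D) (hδ : 0 ≤ δ)
    (hp : ∀ i y, 0 ≤ p i y) (hp1 : ∀ i, ∑ y, p i y = 1) (hu : ∀ i y, |u i y| ≤ D)
    (hmean : ∀ i, ∑ y, p i y * u i y = 0) :
    ∑ ys : ι → β, (∏ i, p i (ys i)) * (if δ < ∑ i, u i (ys i) then 1 else 0) ≤
      Real.exp (-(δ ^ 2 / (2 * Fintype.card ι * D ^ 2))) := by
  have hn : (0 : ℝ) < Fintype.card ι := Nat.cast_pos.mpr Fintype.card_pos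
  set n : ℝ := (Fintype.card ι : ℝ) with hn_def
  set s : ℝ := δ / (n * D ^ 2) with hs
  have hs0 : 0 ≤ s := by positivity
  have hind (ys : ι → β) : (if δ < ∑ i, u i (ys i) then (1 : ℝ) else 0) ≤
      Real.exp (-(s * δ)) * ∏ i, Real.exp (s * u i (ys i)) := by
    rw [← Real.exp_sum, ← Real.exp_add, ← Finset.mul_sum]
    split_ifs with h
    · apply Real.one_le_exp
      nlinarith [mul_le_mul_of_nonneg_left h.le hs0]
    · positivity
  calc _ ≤ ∑ ys : ι → β, (∏ i, p i (ys i)) *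
          (Real.exp (-(s * δ)) * ∏ i, Real.exp (s * u i (ys i))) :=
        Finset.sum_le_sum fun ys _ =>
          mul_le_mul_of_nonneg_left (hind ys) (Finset.prod_nonneg fun i _ => hp i _)
    _ = Real.exp (-(s * δ)) * ∏ i, ∑ y, p i y * Real.exp (s * u i y) := by
        rw [Fintype.prod_sum, Finset.mul_sum]
        refine Finset.sum_congr rfl fun ys _ => ?_
        rw [Finset.prod_mul_distrib]
        ring
    _ ≤ Real.exp (-(s * δ)) * ∏ _i : ι, Real.exp (s ^ 2 * D ^ 2 / 2) := by
        refine mul_le_mul_of_nonneg_left (Finset.prod_le_prod ?_ ?_) (Real.exp_nonneg _)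
        · exact fun i _ => Finset.sum_nonneg fun y _ => mul_nonneg (hp i y) (Real.exp_nonneg _)
        · exact fun i _ => sum_mul_exp_le_of_abs_le hD (hp i) (hp1 i) (hu i) (hmean i) s
    _ = Real.exp (-(δ ^ 2 / (2 * n * D ^ 2))) := by
        rw [Finset.prod_const, Finset.card_univ, ← Real.exp_nat_mul, ← Real.exp_add, ← hn_def, hs]
        congr 1
        field_simp
        ring

theorem abs_log_div_le {m a b : ℝ} (hm : 0 < m) (ha : m ≤ a) (ha1 : a ≤ 1) (hb : m ≤ b)
    (hb1 : b ≤ 1) : |Real.log (a / b)| ≤ -Real.log m := by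
  rw [Real.log_div (hm.trans_le ha).ne' (hm.trans_le hb).ne', abs_le]
  have h1 := Real.log_le_log hm ha
  have h2 := Real.log_le_log hm hb
  have h3 := Real.log_nonpos (hm.le.trans ha) ha1
  have h4 := Real.log_nonpos (hm.le.trans hb) hb1
  constructor <;> linarith

theorem typeDist_nonneg {𝓧 : Type*} [Fintype 𝓧] [DecidableEq 𝓧] {t : ℕ} (xs : Fin t → 𝓧)
    (a : 𝓧) : 0 ≤ typeDist xs a := by
  unfold typeDist; positivity

/-- Averaging over a sequence is averaging against its type. -/
theorem sum_comp_eq_mul_sum_typeDist {𝓧 : Type*} [Fintype 𝓧] [DecidableEq 𝓧] {t : ℕ}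
    (ht : t ≠ 0) (xs : Fin t → 𝓧) (f : 𝓧 → ℝ) :
    ∑ i, f (xs i) = t * ∑ a, typeDist xs a * f a := by
  have ht' : (t : ℝ) ≠ 0 := by exact_mod_cast ht
  rw [← Finset.sum_fiberwise Finset.univ xs fun i => f (xs i), Finset.mul_sum]
  refine Finset.sum_congr rfl fun a _ => ?_
  rw [Finset.sum_congr rfl (g := fun _ => f a)
    fun i hi => by rw [(Finset.mem_filter.mp hi).2]]
  rw [Finset.sum_const, nsmul_eq_mul, typeDist]
  field_simp

theorem sum_typeDist {𝓧 : Type*} [Fintype 𝓧] [DecidableEq 𝓧] {t : ℕ} (ht : t ≠ 0)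
    (xs : Fin t → 𝓧) : ∑ a, typeDist xs a = 1 := by
  have h := sum_comp_eq_mul_sum_typeDist ht xs fun _ => 1
  have ht' : (t : ℝ) ≠ 0 := by exact_mod_cast ht
  simp only [Finset.sum_const, Finset.card_univ, Fintype.card_fin, nsmul_eq_mul, mul_one] at h
  exact mul_left_cancel₀ ht' (by linarith)

theorem tailP_nonneg {𝓧 𝓨 : Type*} [Fintype 𝓧] [Fintype 𝓨] [DecidableEq 𝓧]
    {W : 𝓧 → 𝓨 → ℝ} (hW : ∀ x y, 0 ≤ W x y) {t : ℕ} (xs : Fin t → 𝓧) (lam : ℝ) :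
    0 ≤ tailP W xs lam :=
  Finset.sum_nonneg fun ys _ =>
    mul_nonneg (Finset.prod_nonneg fun i _ => hW _ _) (by split_ifs <;> norm_num)

theorem tailP_of_length_zero {𝓧 𝓨 : Type*} [Fintype 𝓧] [Fintype 𝓨] [DecidableEq 𝓧]
    (W : 𝓧 → 𝓨 → ℝ) (xs : Fin 0 → 𝓧) {lam : ℝ} (hlam : 0 ≤ lam) :
    tailP W xs lam = 0 := by
  simp [tailP, infoDensity, hlam.not_gt]

/-- Hoeffding's inequality for the information density of a channel whose entries are bounded
below by `m`, above the bound `t * C` on its mean. -/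
theorem tailP_le_exp {𝓧 𝓨 : Type*} [Fintype 𝓧] [Fintype 𝓨] [DecidableEq 𝓧]
    {W : 𝓧 → 𝓨 → ℝ} {m C D : ℝ} (hm : 0 < m) (hmW : ∀ x y, m ≤ W x y)
    (hWsum : ∀ x, ∑ y, W x y = 1) (hD : 0 < D) (hmD : -(2 * Real.log m) ≤ D)
    (hC : ∀ P : 𝓧 → ℝ, (∀ x, 0 ≤ P x) → (∑ x, P x) = 1 → mutualInfo P W ≤ C)
    {t : ℕ} (ht : t ≠ 0) (xs : Fin t → 𝓧) {lam : ℝ} (hlam : t * C ≤ lam) :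
    tailP W xs lam ≤ Real.exp (-((lam - t * C) ^ 2 / (2 * t * D ^ 2))) := by
  have : NeZero t := ⟨ht⟩
  have hWnn (x y) : 0 ≤ W x y := hm.le.trans (hmW x y)
  have hW1 (x y) : W x y ≤ 1 := by
    rw [← hWsum x]
    exact Finset.single_le_sum (fun y _ => hWnn x y) (Finset.mem_univ y)
  set P := typeDist xs with hP
  have hP0 : ∀ x, 0 ≤ P x := typeDist_nonneg xs
  have hP1 : ∑ x, P x = 1 := sum_typeDist ht xs
  have hQm (y) : m ≤ ∑ x, P x * W x y :=
    calc m = ∑ x, P x * m := by rw [← Finset.sum_mul, hP1, one_mul]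
      _ ≤ _ := Finset.sum_le_sum fun x _ => mul_le_mul_of_nonneg_left (hmW x y) (hP0 x)
  have hQ1 (y) : ∑ x, P x * W x y ≤ 1 :=
    calc _ ≤ ∑ x, P x * 1 :=
          Finset.sum_le_sum fun x _ => mul_le_mul_of_nonneg_left (hW1 x y) (hP0 x)
      _ = 1 := by simp [hP1]
  set Z : 𝓧 → 𝓨 → ℝ := fun x y => Real.log (W x y / ∑ x', P x' * W x' y) with hZ
  have hZB (x y) : |Z x y| ≤ -Real.log m :=
    abs_log_div_le hm (hmW x y) (hW1 x y) (hQm y) (hQ1 y)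
  set μ : 𝓧 → ℝ := fun x => ∑ y, W x y * Z x y with hμ
  have hμB (x) : |μ x| ≤ -Real.log m :=
    calc |μ x| ≤ ∑ y, |W x y * Z x y| := Finset.abs_sum_le_sum_abs _ _
      _ ≤ ∑ y, W x y * -Real.log m := Finset.sum_le_sum fun y _ => by
          rw [abs_mul, abs_of_nonneg (hWnn x y)]
          exact mul_le_mul_of_nonneg_left (hZB x y) (hWnn x y)
      _ = -Real.log m := by rw [← Finset.sum_mul, hWsum, one_mul]
  have hsum : ∑ i, μ (xs i) ≤ t * C := by
    rw [sum_comp_eq_mul_sum_typeDist ht]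
    refine mul_le_mul_of_nonneg_left ?_ t.cast_nonneg
    refine le_trans (le_of_eq ?_) (hC P hP0 hP1)
    simp only [mutualInfo, hμ, hZ, Finset.mul_sum, mul_assoc, hP]
  have key := sum_prod_mul_indicator_le (ι := Fin t) (p := fun i => W (xs i))
    (u := fun i y => Z (xs i) y - μ (xs i)) (D := D) (δ := lam - t * C) hD (by linarith)
    (fun i => hWnn (xs i)) (fun i => hWsum (xs i))
    (fun i y => by
      have h1 := hZB (xs i) y
      have h2 := hμB (xs i)
      have h3 := abs_sub (Z (xs i) y) (μ (xs i))
      linarith)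
    (fun i => by
      simp only [mul_sub, Finset.sum_sub_distrib, ← Finset.sum_mul, hWsum, one_mul]
      simp [hμ])
  rw [Fintype.card_fin] at key
  refine le_trans (Finset.sum_le_sum fun ys _ => ?_) key
  refine mul_le_mul_of_nonneg_left ?_ (Finset.prod_nonneg fun i _ => hWnn _ _)
  have hinfo : infoDensity P W xs ys = ∑ i, Z (xs i) (ys i) := rfl
  rw [hinfo]
  split_ifs with h1 h2 h2
  · exact le_rfl
  · exfalso
    apply h2
    rw [Finset.sum_sub_distrib]
    linarith
  · norm_num
  · exact le_rfl

theorem tendsto_mul_exp_neg_mul_log_sq {a b c : ℝ} (hc : 0 < c) :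
    Tendsto (fun x : ℝ => (a * x + b) * Real.exp (-(c * Real.log x ^ 2))) atTop (nhds 0) := by
  have hexp : Tendsto (fun y : ℝ => (|a| + |b|) * Real.exp (-y)) atTop (nhds 0) := by
    simpa using Real.tendsto_exp_neg_atTop_nhds_zero.const_mul (|a| + |b|)
  refine squeeze_zero_norm' ?_ (hexp.comp Real.tendsto_log_atTop)
  filter_upwards [eventually_ge_atTop 1, Real.tendsto_log_atTop.eventually_ge_atTop (2 / c),
    Real.tendsto_log_atTop.eventually_ge_atTop 0] with x hx hlog hlog0
  have hx0 : 0 < x := by linarith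
  have hlin : |a * x + b| ≤ (|a| + |b|) * Real.exp (Real.log x) := by
    rw [Real.exp_log hx0]
    calc |a * x + b| ≤ |a * x| + |b| := abs_add_le _ _
      _ ≤ (|a| + |b|) * x := by
          rw [abs_mul, abs_of_pos hx0]
          nlinarith [abs_nonneg b]
  rw [div_le_iff₀ hc] at hlog
  rw [Real.norm_eq_abs, abs_mul, Real.abs_exp, Function.comp_apply]
  calc |a * x + b| * Real.exp (-(c * Real.log x ^ 2))
      ≤ (|a| + |b|) * Real.exp (Real.log x) * Real.exp (-(c * Real.log x ^ 2)) :=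
        mul_le_mul_of_nonneg_right hlin (Real.exp_nonneg _)
    _ = (|a| + |b|) * Real.exp (Real.log x + -(c * Real.log x ^ 2)) := by
        rw [mul_assoc, ← Real.exp_add]
    _ ≤ (|a| + |b|) * Real.exp (-Real.log x) := by
        gcongr
        nlinarith

/-- **Large-deviations regime: vanishing Hoeffding sum.**
Let `W` be a DMC with all entries positive, `C > 0` an upper bound on `I(P, W)` over all
input distributions `P`, and `V > 0`.  With `α(λ) = λ/C − √(Vλ/C³)·log λ`, the sum
`∑_{t=0}^{⌊α(λ)⌋} max_{xᵗ} P[i_{P_{xᵗ},W}(xᵗ; Yᵗ) > λ]` tends to `0` as `λ → ∞`; moreover,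
for each `t ≤ α(λ)` and `λ` large enough, the maximum is at most `(1/λ)^{c·log λ}` for
some constant `c > 0` independent of `t` and `λ`. -/
theorem hoeffding_sum_vanishes {𝓧 𝓨 : Type*} [Fintype 𝓧] [Fintype 𝓨]
    [Nonempty 𝓧] [Nonempty 𝓨] [DecidableEq 𝓧]
    (W : 𝓧 → 𝓨 → ℝ) (hWpos : ∀ x y, 0 < W x y) (hWsum : ∀ x, ∑ y, W x y = 1)
    (C V : ℝ) (hC : 0 < C) (hV : 0 < V)
    (hCbound : ∀ P : 𝓧 → ℝ, (∀ x, 0 ≤ P x) → (∑ x, P x) = 1 → mutualInfo P W ≤ C) :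
    Tendsto
      (fun lam : ℝ =>
        ∑ t ∈ Finset.range (⌊lam / C - Real.sqrt (V * lam / C ^ 3) * Real.log lam⌋₊ + 1),
          ⨆ xs : Fin t → 𝓧, tailP W xs lam)
      atTop (nhds 0) ∧
    ∃ c > (0 : ℝ), ∃ lam0 : ℝ, ∀ lam ≥ lam0, ∀ t : ℕ,
      (t : ℝ) ≤ lam / C - Real.sqrt (V * lam / C ^ 3) * Real.log lam →
      (⨆ xs : Fin t → 𝓧, tailP W xs lam) ≤ (1 / lam) ^ (c * Real.log lam) := by
  obtain ⟨m, hm, hmW⟩ : ∃ m > 0, ∀ x y, m ≤ W x y := by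
    obtain ⟨⟨x₀, y₀⟩, h⟩ := Finite.exists_min fun q : 𝓧 × 𝓨 => W q.1 q.2
    exact ⟨W x₀ y₀, hWpos _ _, fun x y => h (x, y)⟩
  have hWnn (x y) : 0 ≤ W x y := (hWpos x y).le
  obtain ⟨D, hD, hmD⟩ : ∃ D > 0, -(2 * Real.log m) ≤ D :=
    ⟨max 1 (-(2 * Real.log m)), lt_max_of_lt_left one_pos, le_max_right _ _⟩
  set c : ℝ := V / (2 * D ^ 2) with hc_def
  have hc : 0 < c := by positivity
  have main (lam : ℝ) (hlam : 1 ≤ lam) (t : ℕ)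
      (ht : t = 0 ∨ (t : ℝ) ≤ lam / C - Real.sqrt (V * lam / C ^ 3) * Real.log lam) :
      (⨆ xs : Fin t → 𝓧, tailP W xs lam) ≤ Real.exp (-(c * Real.log lam ^ 2)) := by
    refine ciSup_le fun xs => ?_
    rcases eq_or_ne t 0 with rfl | ht0
    · rw [tailP_of_length_zero W xs (by linarith)]
      positivity
    have ht' := ht.resolve_left ht0
    have htpos : (0 : ℝ) < t := by exact_mod_cast Nat.pos_of_ne_zero ht0
    have hlog : 0 ≤ Real.log lam := Real.log_nonneg hlam
    set r := Real.sqrt (V * lam / C ^ 3) with hr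
    have hr2 : r ^ 2 = V * lam / C ^ 3 := Real.sq_sqrt (by positivity)
    have hrl : 0 ≤ r * Real.log lam := mul_nonneg (Real.sqrt_nonneg _) hlog
    have hgap : r * Real.log lam * C ≤ lam - t * C := by
      have h := mul_le_mul_of_nonneg_right ht' hC.le
      rw [sub_mul, div_mul_cancel₀ _ hC.ne'] at h
      linarith
    have hgap0 : 0 ≤ r * Real.log lam * C := mul_nonneg hrl hC.le
    have htC : t * C ≤ lam := by linarith
    refine (tailP_le_exp hm hmW hWsum hD hmD hCbound ht0 xs htC).trans ?_
    rw [Real.exp_le_exp, neg_le_neg_iff, le_div_iff₀ (by positivity)]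
    calc c * Real.log lam ^ 2 * (2 * t * D ^ 2)
        = V * Real.log lam ^ 2 / C * (t * C) := by rw [hc_def]; field_simp
      _ ≤ V * Real.log lam ^ 2 / C * lam := mul_le_mul_of_nonneg_left htC (by positivity)
      _ = (r * Real.log lam * C) ^ 2 := by
          rw [mul_pow, mul_pow, hr2]; field_simp
      _ ≤ (lam - t * C) ^ 2 := pow_le_pow_left₀ hgap0 hgap 2
  refine ⟨?_, c, hc, 1, fun lam hlam t ht => ?_⟩
  · refine squeeze_zero' (Eventually.of_forall fun lam => Finset.sum_nonneg fun t _ =>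
      Real.iSup_nonneg fun xs => tailP_nonneg hWnn xs lam) ?_
      (tendsto_mul_exp_neg_mul_log_sq (a := 1 / C) (b := 1) hc)
    filter_upwards [eventually_ge_atTop 1] with lam hlam
    set α := lam / C - Real.sqrt (V * lam / C ^ 3) * Real.log lam with hα
    have hfloor : (⌊α⌋₊ : ℝ) ≤ 1 / C * lam := by
      have hαle : α ≤ 1 / C * lam := by
        have := mul_nonneg (Real.sqrt_nonneg (V * lam / C ^ 3)) (Real.log_nonneg hlam)
        rw [one_div_mul_eq_div]
        linarith
      exact (Nat.cast_le.mpr (Nat.floor_le_floor hαle)).trans (Nat.floor_le (by positivity))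
    calc _ ≤ ∑ _t ∈ Finset.range (⌊α⌋₊ + 1), Real.exp (-(c * Real.log lam ^ 2)) := by
          refine Finset.sum_le_sum fun t ht => main lam hlam t ?_
          refine (eq_or_ne t 0).imp_right fun ht0 => ?_
          exact (Nat.le_floor_iff' ht0).mp (Nat.lt_succ_iff.mp (Finset.mem_range.mp ht))
      _ = ((⌊α⌋₊ : ℝ) + 1) * Real.exp (-(c * Real.log lam ^ 2)) := by simp
      _ ≤ _ := mul_le_mul_of_nonneg_right (by linarith) (Real.exp_nonneg _)
  · refine (main lam hlam t (Or.inr ht)).trans_eq ?_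
    have hpos : 0 < lam := by linarith
    rw [Real.rpow_def_of_pos (by positivity), one_div, Real.log_inv]
    congr 1
    ring
end
end

section
/- (Existence and uniqueness of Q̃⁻¹.) Fix ρ1, ρ2 > 0 and x ∈ (0,1). The function h(y) = Q(−ρ1·y)·Q(−ρ2·y) + x·(1 + min(Q(−ρ1·y), Q(−ρ2·y))) is continuous and strictly increasing on ℝ, with h(y) → x as y → −∞ and h(y) → 1 + 2x as y → +∞. Consequently, the equation h(y) = 1 has a unique real solution y = Q̃⁻¹(x). -/
open MeasureTheory Real Filter

noncomputable section

/-- The standard normal density `φ(x) = e^{−x²/2}/√(2π)`. -/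
def stdGaussianPDF (x : ℝ) : ℝ := Real.exp (-x ^ 2 / 2) / Real.sqrt (2 * Real.pi)

/-- The standard Gaussian tail function `Q(x) = ∫_x^∞ φ(t) dt`. -/
def gaussQ (x : ℝ) : ℝ := ∫ t in Set.Ioi x, stdGaussianPDF t

/-- The function `h(y) = Q(−ρ₁y)·Q(−ρ₂y) + x·(1 + min(Q(−ρ₁y), Q(−ρ₂y)))` whose unique
root `h(y) = 1` defines `Q̃⁻¹(x)`. -/
def tildeQFun (ρ1 ρ2 x y : ℝ) : ℝ :=
  gaussQ (-(ρ1 * y)) * gaussQ (-(ρ2 * y))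
    + x * (1 + min (gaussQ (-(ρ1 * y))) (gaussQ (-(ρ2 * y))))

lemma stdGaussianPDF_eq_gaussianPDFReal :
    stdGaussianPDF = ProbabilityTheory.gaussianPDFReal 0 1 := by
  ext x
  simp [stdGaussianPDF, ProbabilityTheory.gaussianPDFReal, div_eq_inv_mul]

lemma stdGaussianPDF_pos (x : ℝ) : 0 < stdGaussianPDF x := by
  rw [stdGaussianPDF_eq_gaussianPDFReal]
  exact ProbabilityTheory.gaussianPDFReal_pos 0 1 x one_ne_zero

lemma integrable_stdGaussianPDF : Integrable stdGaussianPDF := by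
  rw [stdGaussianPDF_eq_gaussianPDFReal]
  exact ProbabilityTheory.integrable_gaussianPDFReal 0 1

lemma integral_stdGaussianPDF : ∫ t, stdGaussianPDF t = 1 := by
  rw [stdGaussianPDF_eq_gaussianPDFReal]
  exact ProbabilityTheory.integral_gaussianPDFReal_eq_one 0 one_ne_zero

lemma gaussQ_sub_gaussQ (a b : ℝ) : gaussQ a - gaussQ b = ∫ t in a..b, stdGaussianPDF t :=
  intervalIntegral.integral_Ioi_sub_Ioi' integrable_stdGaussianPDF.integrableOn
    integrable_stdGaussianPDF.integrableOn

lemma continuous_gaussQ : Continuous gaussQ := by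
  have h : gaussQ = fun y => gaussQ 0 - ∫ t in (0 : ℝ)..y, stdGaussianPDF t := by
    ext y
    rw [← gaussQ_sub_gaussQ, sub_sub_cancel]
  rw [h]
  exact continuous_const.sub (integrable_stdGaussianPDF.continuous_primitive 0)

lemma strictAnti_gaussQ : StrictAnti gaussQ := by
  intro a b hab
  rw [← sub_pos, gaussQ_sub_gaussQ]
  exact intervalIntegral.intervalIntegral_pos_of_pos
    integrable_stdGaussianPDF.intervalIntegrable stdGaussianPDF_pos hab

lemma tendsto_gaussQ_atTop : Tendsto gaussQ atTop (nhds 0) := by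
  have h := (intervalIntegral_tendsto_integral_Ioi 0 integrable_stdGaussianPDF.integrableOn
    tendsto_id).const_sub (gaussQ 0)
  simp only [id, ← gaussQ_sub_gaussQ, sub_sub_cancel] at h
  rwa [← gaussQ, sub_self] at h

lemma tendsto_gaussQ_atBot : Tendsto gaussQ atBot (nhds 1) := by
  have h := (intervalIntegral_tendsto_integral_Iic 0 integrable_stdGaussianPDF.integrableOn
    tendsto_id).add_const (gaussQ 0)
  simp only [id, ← gaussQ_sub_gaussQ, sub_add_cancel] at h
  rwa [gaussQ, intervalIntegral.integral_Iic_add_Ioi integrable_stdGaussianPDF.integrableOn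
    integrable_stdGaussianPDF.integrableOn, integral_stdGaussianPDF] at h

lemma gaussQ_pos (x : ℝ) : 0 < gaussQ x :=
  (strictAnti_gaussQ.antitone.le_of_tendsto tendsto_gaussQ_atTop (x + 1)).trans_lt
    (strictAnti_gaussQ (lt_add_one x))

lemma strictMono_gaussQ_neg_mul {ρ : ℝ} (hρ : 0 < ρ) :
    StrictMono fun y => gaussQ (-(ρ * y)) := fun _ _ hab =>
  strictAnti_gaussQ (neg_lt_neg (mul_lt_mul_of_pos_left hab hρ))

lemma tendsto_gaussQ_neg_mul_atTop {ρ : ℝ} (hρ : 0 < ρ) :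
    Tendsto (fun y => gaussQ (-(ρ * y))) atTop (nhds 1) :=
  tendsto_gaussQ_atBot.comp (tendsto_neg_atTop_atBot.comp (tendsto_id.const_mul_atTop hρ))

lemma tendsto_gaussQ_neg_mul_atBot {ρ : ℝ} (hρ : 0 < ρ) :
    Tendsto (fun y => gaussQ (-(ρ * y))) atBot (nhds 0) :=
  tendsto_gaussQ_atTop.comp (tendsto_neg_atBot_atTop.comp (tendsto_id.const_mul_atBot hρ))

lemma continuous_tildeQFun (ρ1 ρ2 x : ℝ) : Continuous (tildeQFun ρ1 ρ2 x) := by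
  have := continuous_gaussQ
  unfold tildeQFun
  fun_prop

lemma strictMono_tildeQFun {ρ1 ρ2 x : ℝ} (hρ1 : 0 < ρ1) (hρ2 : 0 < ρ2) (hx : 0 ≤ x) :
    StrictMono (tildeQFun ρ1 ρ2 x) := by
  intro a b hab
  have h1 := strictMono_gaussQ_neg_mul hρ1 hab
  have h2 := strictMono_gaussQ_neg_mul hρ2 hab
  refine add_lt_add_of_lt_of_le
    (mul_lt_mul'' h1 h2 (gaussQ_pos _).le (gaussQ_pos _).le) ?_
  exact mul_le_mul_of_nonneg_left (add_le_add_right (min_le_min h1.le h2.le) 1) hx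

lemma tendsto_tildeQFun {l : Filter ℝ} {ρ1 ρ2 c : ℝ} (x : ℝ)
    (h1 : Tendsto (fun y => gaussQ (-(ρ1 * y))) l (nhds c))
    (h2 : Tendsto (fun y => gaussQ (-(ρ2 * y))) l (nhds c)) :
    Tendsto (tildeQFun ρ1 ρ2 x) l (nhds (c * c + x * (1 + c))) := by
  have h := (h1.mul h2).add (((h1.min h2).const_add 1).const_mul x)
  rwa [min_self] at h

/-- **Existence and uniqueness of `Q̃⁻¹`.**  For `ρ₁, ρ₂ > 0` and `x ∈ (0,1)`, the function
`h(y) = Q(−ρ₁y)·Q(−ρ₂y) + x·(1 + min_k Q(−ρ_k y))` is continuous and strictly increasing,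
tends to `x` at `−∞` and to `1 + 2x` at `+∞`; consequently `h(y) = 1` has a unique real
solution `y = Q̃⁻¹(x)`. -/
theorem tildeQ_exists_unique (ρ1 ρ2 x : ℝ) (hρ1 : 0 < ρ1) (hρ2 : 0 < ρ2)
    (hx : x ∈ Set.Ioo (0 : ℝ) 1) :
    Continuous (tildeQFun ρ1 ρ2 x) ∧
    StrictMono (tildeQFun ρ1 ρ2 x) ∧
    Tendsto (tildeQFun ρ1 ρ2 x) atBot (nhds x) ∧
    Tendsto (tildeQFun ρ1 ρ2 x) atTop (nhds (1 + 2 * x)) ∧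
    ∃! y : ℝ, tildeQFun ρ1 ρ2 x y = 1 := by
  have hcont := continuous_tildeQFun ρ1 ρ2 x
  have hmono := strictMono_tildeQFun hρ1 hρ2 hx.1.le
  have hbot : Tendsto (tildeQFun ρ1 ρ2 x) atBot (nhds x) := by
    simpa using tendsto_tildeQFun x (tendsto_gaussQ_neg_mul_atBot hρ1)
      (tendsto_gaussQ_neg_mul_atBot hρ2)
  have htop : Tendsto (tildeQFun ρ1 ρ2 x) atTop (nhds (1 + 2 * x)) := by
    convert tendsto_tildeQFun x (tendsto_gaussQ_neg_mul_atTop hρ1)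
      (tendsto_gaussQ_neg_mul_atTop hρ2) using 2
    ring
  refine ⟨hcont, hmono, hbot, htop, ?_⟩
  obtain ⟨a, ha⟩ := (hbot.eventually_lt_const hx.2).exists
  obtain ⟨b, hb⟩ := (htop.eventually_const_lt (by linarith [hx.1] : 1 < 1 + 2 * x)).exists
  obtain ⟨y, hy⟩ := mem_range_of_exists_le_of_exists_ge hcont ⟨a, ha.le⟩ ⟨b, hb.le⟩
  exact ⟨y, hy, fun z hz => hmono.injective (hz.trans hy.symm)⟩
end
end
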